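/- Let n ≥ 1 and 1 ≤ k ≤ n+1, and let μ = [[0, −B u*], [u B, D]] be the block matrix built from a partial isometry u, a positive matrix B with B u* u = B, and a skew-Hermitian matrix D. Then the M×M matrix i^{n+1}(μ H^{n-1}_{k-1}(μ))₋₋ is skew-Hermitian. -/

import Mathlib

open Matrix Complex
open scoped ComplexOrder

/-- `H^n_k(X) = Σ P^{i₀} X P^{i₁} X ⋯ X P^{iₙ}`, sum over `(i₀,…,iₙ) ∈ {0,1}^{n+1}`
with `i₀+⋯+iₙ = k`. -/
noncomputable def Hpoly {ι : Type*} [Fintype ι] [DecidableEq ι]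
    (P X : Matrix ι ι ℂ) (n k : ℕ) : Matrix ι ι ℂ :=
  ∑ c ∈ Finset.univ.filter (fun c : Fin (n + 1) → Fin 2 => (∑ j, (c j : ℕ)) = k),
    (List.ofFn fun j : Fin n => P ^ (c j.castSucc : ℕ) * X).prod * P ^ (c (Fin.last n) : ℕ)

/-- The projector onto the first (`+`) summand. -/
noncomputable def Pplus (N M : ℕ) : Matrix (Fin N ⊕ Fin M) (Fin N ⊕ Fin M) ℂ :=
  Matrix.fromBlocks 1 0 0 0

/-- The block matrix `μ = [[0, −B u*], [u B, D]]`. -/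
noncomputable def muBlock {N M : ℕ} (u : Matrix (Fin M) (Fin N) ℂ)
    (B : Matrix (Fin N) (Fin N) ℂ) (D : Matrix (Fin M) (Fin M) ℂ) :
    Matrix (Fin N ⊕ Fin M) (Fin N ⊕ Fin M) ℂ :=
  Matrix.fromBlocks 0 (-(B * uᴴ)) (u * B) D

/-- The sum of all words `X P^{i₁} X ⋯ P^{iₘ} X` with `i₁ + ⋯ + iₘ = k`, `iⱼ ∈ {0, 1}`. -/
def wordSum {R : Type*} [Ring R] (P X : R) : ℕ → ℕ → R
  | 0, 0 => X
  | 0, _ + 1 => 0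
  | m + 1, 0 => X * wordSum P X m 0
  | m + 1, k + 1 => X * wordSum P X m (k + 1) + X * P * wordSum P X m k

section wordSum

variable {R : Type*} [Ring R] (P X : R)

theorem wordSum_succ_zero (m : ℕ) : wordSum P X (m + 1) 0 = X * wordSum P X m 0 := by
  rw [wordSum]

theorem wordSum_succ_succ (m k : ℕ) :
    wordSum P X (m + 1) (k + 1) =
      X * wordSum P X m (k + 1) + X * P * wordSum P X m k := by
  rw [wordSum]

theorem wordSum_succ_zero_right (m : ℕ) :
    wordSum P X (m + 1) 0 = wordSum P X m 0 * X := by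
  induction m with
  | zero => simp [wordSum]
  | succ m ih => rw [wordSum_succ_zero, ih, ← mul_assoc, ← wordSum_succ_zero, ← ih]

theorem wordSum_succ_succ_right (m k : ℕ) :
    wordSum P X (m + 1) (k + 1) =
      wordSum P X m (k + 1) * X + wordSum P X m k * P * X := by
  induction m generalizing k with
  | zero => cases k <;> simp [wordSum]
  | succ m ih =>
    conv_lhs => rw [wordSum_succ_succ, ih]
    conv_rhs => rw [wordSum_succ_succ]
    cases k with
    | zero =>
      conv_lhs => rw [wordSum_succ_zero_right]
      conv_rhs => rw [wordSum_succ_zero]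
      noncomm_ring
    | succ k =>
      conv_lhs => rw [ih]
      conv_rhs => rw [wordSum_succ_succ]
      noncomm_ring

theorem star_wordSum [StarRing R] (hP : star P = P) (hX : star X = -X) (m k : ℕ) :
    star (wordSum P X m k) = (-1) ^ (m + 1) * wordSum P X m k := by
  induction m generalizing k with
  | zero => cases k <;> simp [wordSum, hX]
  | succ m ih =>
    cases k with
    | zero =>
      nth_rewrite 1 [wordSum_succ_zero]
      rw [star_mul, ih, hX, wordSum_succ_zero_right, pow_succ _ (m + 1)]
      noncomm_ring
    | succ k =>
      nth_rewrite 1 [wordSum_succ_succ]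
      rw [star_add, star_mul, star_mul, star_mul, ih, ih, hX, hP,
        wordSum_succ_succ_right, pow_succ _ (m + 1)]
      noncomm_ring

end wordSum

section Hpoly

variable {ι : Type*} [Fintype ι] [DecidableEq ι] (P X : Matrix ι ι ℂ)

theorem Hpoly_zero_zero : Hpoly P X 0 0 = 1 := by
  rw [Hpoly, Finset.sum_filter, ← (Equiv.funUnique (Fin 1) (Fin 2)).symm.sum_comp]
  simp

theorem Hpoly_zero_one : Hpoly P X 0 1 = P := by
  rw [Hpoly, Finset.sum_filter, ← (Equiv.funUnique (Fin 1) (Fin 2)).symm.sum_comp]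
  simp

theorem Hpoly_zero_add_two (k : ℕ) : Hpoly P X 0 (k + 2) = 0 := by
  rw [Hpoly, Finset.sum_filter, ← (Equiv.funUnique (Fin 1) (Fin 2)).symm.sum_comp]
  simp

theorem Hpoly_succ_zero (m : ℕ) : Hpoly P X (m + 1) 0 = X * Hpoly P X m 0 := by
  simp only [Hpoly, Finset.sum_filter]
  rw [← (Fin.consEquiv fun _ : Fin (m + 2) => Fin 2).sum_comp, Fintype.sum_prod_type,
    Fin.sum_univ_two, Finset.mul_sum]
  simp [Fin.consEquiv, Fin.sum_univ_succ (n := m + 1), List.ofFn_succ,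
    ← Fin.succ_last, mul_assoc]

theorem Hpoly_succ_succ (m k : ℕ) :
    Hpoly P X (m + 1) (k + 1) = X * Hpoly P X m (k + 1) + P * X * Hpoly P X m k := by
  simp only [Hpoly, Finset.sum_filter]
  rw [← (Fin.consEquiv fun _ : Fin (m + 2) => Fin 2).sum_comp, Fintype.sum_prod_type,
    Fin.sum_univ_two, Finset.mul_sum, Finset.mul_sum]
  simp [Fin.consEquiv, Fin.sum_univ_succ (n := m + 1), List.ofFn_succ,
    ← Fin.succ_last, mul_assoc, add_comm 1]

theorem mul_Hpoly_mul_of_mul_eq_zero {Q : Matrix ι ι ℂ} (hPQ : P * Q = 0) (m k : ℕ) :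
    X * Hpoly P X m k * Q = wordSum P X m k * Q := by
  induction m generalizing k with
  | zero =>
    match k with
    | 0 => simp [Hpoly_zero_zero, wordSum]
    | 1 => simp [Hpoly_zero_one, wordSum, mul_assoc, hPQ]
    | k + 2 => simp [Hpoly_zero_add_two, wordSum]
  | succ m ih =>
    cases k with
    | zero => rw [Hpoly_succ_zero, wordSum_succ_zero, mul_assoc, ih, mul_assoc]
    | succ k =>
      rw [Hpoly_succ_succ, wordSum_succ_succ, mul_add, add_mul, add_mul, mul_assoc X (_ * _), ih,
        mul_assoc X (wordSum _ _ _ _), mul_assoc (X * P), ← ih k]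
      simp only [mul_assoc]

end Hpoly

theorem conjTranspose_muBlock {N M : ℕ} (u : Matrix (Fin M) (Fin N) ℂ)
    {B : Matrix (Fin N) (Fin N) ℂ} (hB : B.IsHermitian)
    {D : Matrix (Fin M) (Fin M) ℂ} (hD : Dᴴ = -D) :
    (muBlock u B D)ᴴ = -muBlock u B D := by
  simp [muBlock, fromBlocks_conjTranspose, fromBlocks_neg, hB.eq, hD]

theorem conjTranspose_Pplus (N M : ℕ) : (Pplus N M)ᴴ = Pplus N M := by
  simp [Pplus, fromBlocks_conjTranspose]

theorem toBlocks₂₂_mul_Hpoly_Pplus {N M : ℕ}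
    (X : Matrix (Fin N ⊕ Fin M) (Fin N ⊕ Fin M) ℂ) (m k : ℕ) :
    (X * Hpoly (Pplus N M) X m k).toBlocks₂₂ = (wordSum (Pplus N M) X m k).toBlocks₂₂ := by
  have toBlocks₂₂_mul (Y : Matrix (Fin N ⊕ Fin M) (Fin N ⊕ Fin M) ℂ) :
      (Y * fromBlocks 0 0 0 1).toBlocks₂₂ = Y.toBlocks₂₂ := by
    conv_lhs => rw [← fromBlocks_toBlocks Y, fromBlocks_multiply]
    simp
  rw [← toBlocks₂₂_mul, mul_Hpoly_mul_of_mul_eq_zero, toBlocks₂₂_mul]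
  simp [Pplus, fromBlocks_multiply]

/-- the `M×M` matrix `i^{n+1} (μ H^{n-1}_{k-1}(μ))₋₋` is skew-Hermitian. -/
theorem stmt_16 (N M : ℕ) (hN : 0 < N) (hM : 0 < M)
    (n k : ℕ) (hn : 1 ≤ n) (hk1 : 1 ≤ k) (hk2 : k ≤ n + 1)
    (u : Matrix (Fin M) (Fin N) ℂ) (hu : u * uᴴ * u = u)
    (B : Matrix (Fin N) (Fin N) ℂ) (hB : B.PosSemidef) (hBu : B * (uᴴ * u) = B)
    (D : Matrix (Fin M) (Fin M) ℂ) (hD : Dᴴ = -D) :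
    (Complex.I ^ (n + 1) •
        (muBlock u B D * Hpoly (Pplus N M) (muBlock u B D) (n - 1) (k - 1)).toBlocks₂₂)ᴴ =
      -(Complex.I ^ (n + 1) •
        (muBlock u B D * Hpoly (Pplus N M) (muBlock u B D) (n - 1) (k - 1)).toBlocks₂₂) := by
  obtain ⟨m, rfl⟩ : ∃ m, n = m + 1 := ⟨n - 1, by lia⟩
  have hstar := star_wordSum (Pplus N M) (muBlock u B D) (conjTranspose_Pplus N M)
    (conjTranspose_muBlock u hB.isHermitian hD) m (k - 1)
  rw [Nat.add_sub_cancel, toBlocks₂₂_mul_Hpoly_Pplus, conjTranspose_smul]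
  set W := wordSum (Pplus N M) (muBlock u B D) m (k - 1)
  have hW : W.toBlocks₂₂ᴴ = (-1 : ℂ) ^ (m + 1) • W.toBlocks₂₂ := by
    have hsmul : Wᴴ = (-1 : ℂ) ^ (m + 1) • W := by
      rw [← star_eq_conjTranspose, hstar]
      rcases Nat.even_or_odd (m + 1) with h | h <;> simp [h.neg_one_pow]
    exact congrArg toBlocks₂₂ hsmul
  rw [hW, smul_smul, ← neg_smul, star_pow, star_def, conj_I, neg_pow I, mul_right_comm, ← pow_add,
    Odd.neg_one_pow ⟨m + 1, by ring⟩, neg_one_mul]
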